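/- For every probability vector α with strictly positive entries on a finite set Ω, there exists r* ∈ ℝ^d such that A^T π(r*) = A^T α, where π(r) = exp(A r + b)/Z(r). In other words, every point of the interior of the convex hull of the rows of A (with strictly positive barycentric weights) is achievable as A^T π(r) for some finite r. -/

import Mathlib

open Real Finset

/-- For `a > 0`, the function `x ↦ exp (x + b) - a * x` grows at least linearly at both ends. -/
lemma exists_mul_abs_le_exp_sub {a : ℝ} (ha : 0 < a) (b : ℝ) :
    ∃ K : ℝ, ∀ x : ℝ, a * |x| ≤ Real.exp (x + b) - a * x + K := by
  refine ⟨|2 * a * (b + 1 - Real.log (2 * a))|, fun x => ?_⟩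
  have hK := neg_abs_le (2 * a * (b + 1 - Real.log (2 * a)))
  have hK0 := abs_nonneg (2 * a * (b + 1 - Real.log (2 * a)))
  rcases le_total x 0 with hx | hx
  · rw [abs_of_nonpos hx]
    linarith [Real.exp_pos (x + b)]
  · rw [abs_of_nonneg hx]
    have h := Real.add_one_le_exp (x + b - Real.log (2 * a))
    rw [Real.exp_sub, Real.exp_log (by positivity), le_div_iff₀ (by positivity)] at h
    linarith

lemma exists_isMinOn_sum_exp_sub {Ω : Type*} [Fintype Ω] (W : Submodule ℝ (Ω → ℝ))
    (b α : Ω → ℝ) (hα : ∀ s, 0 < α s) :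
    ∃ y ∈ W, IsMinOn (fun y : Ω → ℝ => ∑ s, (Real.exp (y s + b s) - α s * y s)) W y := by
  choose K hK using fun s => exists_mul_abs_le_exp_sub (hα s) (b s)
  set G : (Ω → ℝ) → ℝ := fun y => ∑ s, (Real.exp (y s + b s) - α s * y s) with hG
  have hGc : Continuous G := by fun_prop
  refine hGc.continuousOn.exists_isMinOn' W.closed_of_finiteDimensional W.zero_mem
    (Filter.Eventually.filter_mono inf_le_left ?_)
  let M : Ω → ℝ := fun s => (G 0 + ∑ t, K t) / α s
  refine Filter.mem_cocompact.2 ⟨Set.Icc (-M) M, isCompact_Icc, fun y hy => ?_⟩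
  by_contra! hlt
  have hlt : G y < G 0 := not_le.1 hlt
  have hbound (s : Ω) : |y s| ≤ M s := by
    rw [le_div_iff₀ (hα s), mul_comm]
    calc α s * |y s| ≤ ∑ t, α t * |y t| :=
          single_le_sum (f := fun t => α t * |y t|)
            (fun t _ => mul_nonneg (hα t).le (abs_nonneg _)) (mem_univ s)
      _ ≤ ∑ t, (Real.exp (y t + b t) - α t * y t + K t) := sum_le_sum fun t _ => hK t (y t)
      _ = G y + ∑ t, K t := sum_add_distrib
      _ ≤ G 0 + ∑ t, K t := by linarith
  exact hy ⟨fun s => (abs_le.1 (hbound s)).1, fun s => (abs_le.1 (hbound s)).2⟩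

/-- Every positive vector agrees, as a functional on a subspace `W`, with some `exp (y + b)`
where `y ∈ W`. -/
lemma exists_mem_sum_mul_exp_eq {Ω : Type*} [Fintype Ω] (W : Submodule ℝ (Ω → ℝ))
    (b α : Ω → ℝ) (hα : ∀ s, 0 < α s) :
    ∃ y ∈ W, ∀ v ∈ W, ∑ s, v s * Real.exp (y s + b s) = ∑ s, v s * α s := by
  obtain ⟨y, hyW, hy⟩ := exists_isMinOn_sum_exp_sub W b α hα
  refine ⟨y, hyW, fun v hv => ?_⟩
  have hderiv : HasDerivAt
      (fun t : ℝ => ∑ s, (Real.exp ((y s + t * v s) + b s) - α s * (y s + t * v s)))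
      (∑ s, (Real.exp (y s + b s) * v s - α s * v s)) 0 := by
    refine HasDerivAt.fun_sum fun s _ => ?_
    have hlin : HasDerivAt (fun t : ℝ => y s + t * v s) (v s) 0 := by
      simpa using ((hasDerivAt_id (0 : ℝ)).mul_const (v s)).const_add (y s)
    simpa using (hlin.add_const (b s)).exp.fun_sub (hlin.const_mul (α s))
  have hmin : IsLocalMin
      (fun t : ℝ => ∑ s, (Real.exp ((y s + t * v s) + b s) - α s * (y s + t * v s))) 0 :=
    Filter.Eventually.of_forall fun t => by
      simpa using hy (W.add_mem hyW (W.smul_mem t hv))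
  have h := hmin.hasDerivAt_eq_zero hderiv
  rw [sum_sub_distrib, sub_eq_zero] at h
  simpa only [mul_comm] using h

theorem stmt_4 {Ω : Type*} [Fintype Ω] {d : ℕ}
    (A : Ω → Fin d → ℝ) (b : Ω → ℝ) (α : Ω → ℝ)
    (hα : ∀ s, 0 < α s) (hα1 : ∑ s, α s = 1) :
    ∃ r : Fin d → ℝ, ∀ i : Fin d,
      ∑ s, A s i * (Real.exp ((∑ j, A s j * r j) + b s) /
          ∑ t, Real.exp ((∑ j, A t j * r j) + b t))
        = ∑ s, A s i * α s := by
  let L : (Fin d → ℝ) × ℝ →ₗ[ℝ] Ω → ℝ :=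
    (Matrix.mulVecLin (Matrix.of A)).coprod (LinearMap.toSpanSingleton ℝ (Ω → ℝ) 1)
  have hL (r : Fin d → ℝ) (c : ℝ) (s : Ω) : L (r, c) s = (∑ j, A s j * r j) + c := by
    simp [L, Matrix.mulVec, dotProduct]
  obtain ⟨_, ⟨⟨r, c⟩, rfl⟩, h⟩ := exists_mem_sum_mul_exp_eq (LinearMap.range L) b α hα
  have hexp (s : Ω) : Real.exp (L (r, c) s + b s) =
      Real.exp c * Real.exp ((∑ j, A s j * r j) + b s) := by
    rw [hL, ← Real.exp_add]
    ring_nf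
  simp only [hexp] at h
  have hZ : Real.exp c * ∑ t, Real.exp ((∑ j, A t j * r j) + b t) = 1 := by
    have h1 := h _ ⟨(0, 1), rfl⟩
    simpa only [hL, Pi.zero_apply, mul_zero, sum_const_zero, zero_add, one_mul, hα1,
      ← mul_sum] using h1
  refine ⟨r, fun i => ?_⟩
  have hi := h _ ⟨(Pi.single i 1, 0), rfl⟩
  simp only [hL, Pi.single_apply, mul_ite, mul_one, mul_zero, sum_ite_eq', mem_univ,
    if_true, add_zero] at hi
  rw [← hi]
  refine sum_congr rfl fun s _ => ?_
  rw [div_eq_mul_inv, ← eq_inv_of_mul_eq_one_left hZ, mul_comm (Real.exp c)]
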